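/- Let L, L_r, L_s, Σ, R, Q be a normed continuous-time Markov game structure, fix t ∈ ℝ and 0 < ε ≤ 1, and let x : L → ℝ satisfy x(l) ∈ [0,1] for all l. Let f : L → ℝ → ℝ solve the Bellman equations on [t−ε, t] with terminal value x and take values in [0,1] on [t−ε,t]. Let p1 be a single ε-net approximation from x, and let p2 : L → ℝ → ℝ satisfy p2(l,t) = x(l) and, for every l ∈ L and τ ∈ [t−ε,t], the derivative of p2(l,·) at τ equals −opt_l over a ∈ Σ(l) of Σ_{l'} R(l,a,l')·(p1(l',τ) − p1(l,τ)). Then ‖p2(·, t−ε) − f(·, t−ε)‖ ≤ (2/3)·ε³, where ‖·‖ is the sup-norm over locations. -/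

import Mathlib

/-- A normed continuous-time Markov game structure: a finite nonempty set `L` of
locations partitioned into reachability locations (`isReach l = true`) and safety
locations (`isReach l = false`), a finite set `A` of actions with a nonempty set
`enabled l` of enabled actions at each location, and a rate matrix `R` whose rows
(for enabled actions) are probability distributions on `L`. -/
structure NCTMG (L A : Type) [Fintype L] [DecidableEq L] [Fintype A] where
  isReach : L → Bool
  enabled : L → Finset A
  enabled_nonempty : ∀ l, (enabled l).Nonempty
  R : L → A → L → ℝ
  R_nonneg : ∀ l a l', a ∈ enabled l → 0 ≤ R l a l'
  R_sum : ∀ l a, a ∈ enabled l → (∑ l', R l a l') = 1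

namespace NCTMG

variable {L A : Type} [Fintype L] [DecidableEq L] [Fintype A]

/-- The generator `Q(l,a,l') = R(l,a,l') − δ_{l,l'}`. -/
def Q (M : NCTMG L A) (l : L) (a : A) (l' : L) : ℝ :=
  M.R l a l' - (if l = l' then 1 else 0)

/-- `opt_l`: maximum over enabled actions at reachability locations, minimum
over enabled actions at safety locations. -/
noncomputable def opt (M : NCTMG L A) (l : L) (v : A → ℝ) : ℝ :=
  if M.isReach l then (M.enabled l).sup' (M.enabled_nonempty l) v
  else (M.enabled l).inf' (M.enabled_nonempty l) v

/-- `f` solves the Bellman equations on `[t−ε, t]` with terminal value `x`. -/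
def SolvesBellman (M : NCTMG L A) (t ε : ℝ) (x : L → ℝ) (f : L → ℝ → ℝ) : Prop :=
  (∀ l, f l t = x l) ∧
  ∀ l, ∀ τ ∈ Set.Icc (t - ε) t,
    HasDerivAt (f l) (-(M.opt l (fun a => ∑ l', M.Q l a l' * f l' τ))) τ

/-- `p1` is a single `ε`-net approximation from terminal value `x` with chosen
actions `act`: each `act l` is enabled and attains `opt_l` of `∑ Q(l,a,·)·x`,
and `p1(l, t−τ) = x(l) + τ·c_l` on `[0,ε]` where `c_l = ∑ Q(l,act l,·)·x`. -/
def IsSingleNet (M : NCTMG L A) (t ε : ℝ) (x : L → ℝ) (act : L → A)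
    (p1 : L → ℝ → ℝ) : Prop :=
  (∀ l, act l ∈ M.enabled l) ∧
  (∀ l, (∑ l', M.Q l (act l) l' * x l') =
      M.opt l (fun a => ∑ l', M.Q l a l' * x l')) ∧
  (∀ l, ∀ τ ∈ Set.Icc (0 : ℝ) ε,
      p1 l (t - τ) = x l + τ * (∑ l', M.Q l (act l) l' * x l'))

end NCTMG

/-- The sup-norm `‖v‖ = max_{l∈L} |v l|` on functions `L → ℝ`. -/
noncomputable def supNorm {L : Type} [Fintype L] [Nonempty L] (v : L → ℝ) : ℝ :=
  Finset.univ.sup' Finset.univ_nonempty (fun l => |v l|)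

namespace NCTMG

variable {L A : Type} [Fintype L] [DecidableEq L] [Fintype A]

theorem opt_le_opt_add (M : NCTMG L A) (l : L) {u v : A → ℝ} {δ : ℝ}
    (h : ∀ a ∈ M.enabled l, u a ≤ v a + δ) : M.opt l u ≤ M.opt l v + δ := by
  unfold opt
  split_ifs
  · exact Finset.sup'_le _ _ fun a ha =>
      (h a ha).trans (add_le_add_left (Finset.le_sup' v ha) δ)
  · rw [← sub_le_iff_le_add]
    exact Finset.le_inf' _ _ fun a ha =>
      sub_le_iff_le_add.2 ((Finset.inf'_le u ha).trans (h a ha))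

theorem abs_opt_sub_opt_le (M : NCTMG L A) (l : L) {u v : A → ℝ} {δ : ℝ}
    (h : ∀ a ∈ M.enabled l, |u a - v a| ≤ δ) : |M.opt l u - M.opt l v| ≤ δ := by
  rw [abs_sub_le_iff]
  constructor
  · have := M.opt_le_opt_add l (u := u) (v := v) (δ := δ) fun a ha => by
      linarith [(abs_le.1 (h a ha)).2]
    linarith
  · have := M.opt_le_opt_add l (u := v) (v := u) (δ := δ) fun a ha => by
      linarith [(abs_le.1 (h a ha)).1]
    linarith

theorem opt_zero (M : NCTMG L A) (l : L) : M.opt l (fun _ => 0) = 0 := by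
  simp [opt]

theorem sum_Q_mul (M : NCTMG L A) (l : L) (a : A) (v : L → ℝ) :
    ∑ l', M.Q l a l' * v l' = ∑ l', M.R l a l' * v l' - v l := by
  simp [Q, sub_mul, Finset.sum_sub_distrib]

theorem sum_R_mul_sub (M : NCTMG L A) {l : L} {a : A} (ha : a ∈ M.enabled l) (v : L → ℝ) :
    ∑ l', M.R l a l' * (v l' - v l) = ∑ l', M.Q l a l' * v l' := by
  rw [sum_Q_mul]
  simp [mul_sub, Finset.sum_sub_distrib, ← Finset.sum_mul, M.R_sum l a ha]

theorem sum_R_mul_mem_Icc (M : NCTMG L A) {l : L} {a : A} (ha : a ∈ M.enabled l) {v : L → ℝ}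
    {b c : ℝ} (hv : ∀ l', v l' ∈ Set.Icc b c) : ∑ l', M.R l a l' * v l' ∈ Set.Icc b c := by
  have hR := M.R_sum l a ha
  constructor
  · calc b = ∑ l', M.R l a l' * b := by rw [← Finset.sum_mul, hR, one_mul]
      _ ≤ _ := Finset.sum_le_sum fun l' _ =>
        mul_le_mul_of_nonneg_left (hv l').1 (M.R_nonneg l a l' ha)
  · calc _ ≤ ∑ l', M.R l a l' * c := Finset.sum_le_sum fun l' _ =>
        mul_le_mul_of_nonneg_left (hv l').2 (M.R_nonneg l a l' ha)
      _ = c := by rw [← Finset.sum_mul, hR, one_mul]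

theorem abs_sum_Q_mul_le (M : NCTMG L A) {l : L} {a : A} (ha : a ∈ M.enabled l) {v : L → ℝ}
    {b c : ℝ} (hv : ∀ l', v l' ∈ Set.Icc b c) : |∑ l', M.Q l a l' * v l'| ≤ c - b := by
  have h := M.sum_R_mul_mem_Icc ha hv
  have hl := hv l
  rw [sum_Q_mul, abs_le]
  constructor <;> linarith [h.1, h.2, hl.1, hl.2]

theorem abs_sum_Q_mul_sub_le (M : NCTMG L A) {l : L} {a : A} (ha : a ∈ M.enabled l)
    {v w : L → ℝ} {δ : ℝ} (h : ∀ l', |v l' - w l'| ≤ δ) :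
    |∑ l', M.Q l a l' * v l' - ∑ l', M.Q l a l' * w l'| ≤ 2 * δ := by
  rw [← Finset.sum_sub_distrib]
  simp_rw [← mul_sub]
  have := M.abs_sum_Q_mul_le ha (v := fun l' => v l' - w l') fun l' => abs_le.1 (h l')
  linarith

end NCTMG

/-- A function vanishing at `t` whose derivative is bounded by `C * (n + 1) * (t - τ) ^ n`
on `[t - ε, t]` is bounded there by `C * (t - τ) ^ (n + 1)`. -/
theorem abs_le_mul_pow_of_abs_deriv_le {t ε C : ℝ} (n : ℕ) {h h' : ℝ → ℝ} (ht : h t = 0)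
    (hd : ∀ τ ∈ Set.Icc (t - ε) t, HasDerivAt h (h' τ) τ)
    (hb : ∀ τ ∈ Set.Icc (t - ε) t, |h' τ| ≤ C * ((n + 1) * (t - τ) ^ n))
    {τ : ℝ} (hτ : τ ∈ Set.Icc (t - ε) t) : |h τ| ≤ C * (t - τ) ^ (n + 1) := by
  have hmem : ∀ s ∈ Set.Icc 0 ε, t - s ∈ Set.Icc (t - ε) t := fun s hs =>
    ⟨by linarith [hs.2], by linarith [hs.1]⟩
  have hder : ∀ s ∈ Set.Icc 0 ε, HasDerivAt (fun s => h (t - s)) (-h' (t - s)) s :=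
    fun s hs => (hd _ (hmem s hs)).comp_const_sub t s
  have key := image_norm_le_of_norm_deriv_right_le_deriv_boundary (a := 0) (b := ε)
    (f := fun s => h (t - s)) (f' := fun s => -h' (t - s))
    (B := fun s => C * s ^ (n + 1)) (B' := fun s => C * ((n + 1) * s ^ n))
    (fun s hs => (hder s hs).continuousAt.continuousWithinAt)
    (fun s hs => (hder s (Set.Ico_subset_Icc_self hs)).hasDerivWithinAt)
    (by simp [ht])
    (fun s => by simpa using (hasDerivAt_pow (n + 1) s).const_mul C)
    (fun s hs => by simpa using hb _ (hmem s (Set.Ico_subset_Icc_self hs)))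
    (x := t - τ) ⟨by linarith [hτ.2], by linarith [hτ.1]⟩
  simpa using key

namespace NCTMG

variable {L A : Type} [Fintype L] [DecidableEq L] [Fintype A]

theorem SolvesBellman.abs_sub_terminal_le {M : NCTMG L A} {t ε : ℝ} {x : L → ℝ} {f : L → ℝ → ℝ}
    (hf : M.SolvesBellman t ε x f)
    (hf01 : ∀ l, ∀ τ ∈ Set.Icc (t - ε) t, f l τ ∈ Set.Icc (0 : ℝ) 1)
    (l : L) {τ : ℝ} (hτ : τ ∈ Set.Icc (t - ε) t) : |f l τ - x l| ≤ t - τ := by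
  have := abs_le_mul_pow_of_abs_deriv_le (C := 1) 0 (h := fun τ => f l τ - x l)
    (by simp [hf.1 l]) (fun σ hσ => (hf.2 l σ hσ).sub_const (x l))
    (fun σ hσ => by
      have := M.abs_opt_sub_opt_le l (u := fun a => ∑ l', M.Q l a l' * f l' σ) (v := fun _ => 0)
        (δ := 1) fun a ha => by
          simpa using M.abs_sum_Q_mul_le ha fun l' => hf01 l' σ hσ
      simpa [M.opt_zero l] using this) hτ
  simpa using this

theorem IsSingleNet.abs_sub_le {M : NCTMG L A} {t ε : ℝ} {x : L → ℝ} {act : L → A}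
    {f p1 : L → ℝ → ℝ} (hp1 : M.IsSingleNet t ε x act p1) (hf : M.SolvesBellman t ε x f)
    (hf01 : ∀ l, ∀ τ ∈ Set.Icc (t - ε) t, f l τ ∈ Set.Icc (0 : ℝ) 1)
    (l : L) {τ : ℝ} (hτ : τ ∈ Set.Icc (t - ε) t) : |p1 l τ - f l τ| ≤ (t - τ) ^ 2 := by
  have hp : p1 l τ = x l + (t - τ) * M.opt l (fun a => ∑ l', M.Q l a l' * x l') := by
    rw [← hp1.2.1 l, ← hp1.2.2 l (t - τ) ⟨by linarith [hτ.2], by linarith [hτ.1]⟩,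
      sub_sub_cancel]
  have := abs_le_mul_pow_of_abs_deriv_le (C := 1) 1
    (h := fun τ => x l + (t - τ) * M.opt l (fun a => ∑ l', M.Q l a l' * x l') - f l τ)
    (by simp [hf.1 l])
    (fun σ hσ => ((((hasDerivAt_id σ).const_sub t).mul_const _).const_add (x l)).sub
      (hf.2 l σ hσ))
    (fun σ hσ => by
      have := M.abs_opt_sub_opt_le l fun a ha =>
        M.abs_sum_Q_mul_sub_le ha fun l' => hf.abs_sub_terminal_le hf01 l' hσ
      refine (le_of_eq ?_).trans (this.trans (le_of_eq ?_))
      · congr 1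
        ring
      · push_cast
        ring) hτ
  rw [hp]
  simpa using this

end NCTMG

/-- the double ε-net approximation `p2`, obtained by integrating
the Bellman right-hand side with the single ε-net approximation `p1`
substituted for `f`, has step error at most `(2/3)·ε³`. -/
theorem double_net_step_error {L A : Type} [Fintype L] [DecidableEq L]
    [Nonempty L] [Fintype A] (M : NCTMG L A) (t ε : ℝ) (hε0 : 0 < ε)
    (hε1 : ε ≤ 1)
    (x : L → ℝ) (hx : ∀ l, x l ∈ Set.Icc (0 : ℝ) 1)
    (f : L → ℝ → ℝ) (hf : M.SolvesBellman t ε x f)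
    (hf01 : ∀ l, ∀ τ ∈ Set.Icc (t - ε) t, f l τ ∈ Set.Icc (0 : ℝ) 1)
    (act : L → A) (p1 : L → ℝ → ℝ) (hp1 : M.IsSingleNet t ε x act p1)
    (p2 : L → ℝ → ℝ)
    (hp2t : ∀ l, p2 l t = x l)
    (hp2 : ∀ l, ∀ τ ∈ Set.Icc (t - ε) t,
      HasDerivAt (p2 l)
        (-(M.opt l (fun a => ∑ l', M.R l a l' * (p1 l' τ - p1 l τ)))) τ) :
    supNorm (fun l => p2 l (t - ε) - f l (t - ε)) ≤ (2 / 3) * ε ^ 3 := by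
  refine Finset.sup'_le _ _ fun l _ => ?_
  have := abs_le_mul_pow_of_abs_deriv_le (C := 2 / 3) 2 (h := fun τ => p2 l τ - f l τ)
    (by simp [hp2t l, hf.1 l])
    (fun σ hσ => (hp2 l σ hσ).sub (hf.2 l σ hσ))
    (fun σ hσ => by
      have := M.abs_opt_sub_opt_le l
        (u := fun a => ∑ l', M.R l a l' * (p1 l' σ - p1 l σ))
        (v := fun a => ∑ l', M.Q l a l' * f l' σ) fun a ha => by
          rw [M.sum_R_mul_sub ha fun l' => p1 l' σ]
          exact M.abs_sum_Q_mul_sub_le ha fun l' => hp1.abs_sub_le hf hf01 l' hσ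
      rw [neg_sub_neg, abs_sub_comm]
      refine this.trans (le_of_eq ?_)
      push_cast
      ring)
    (τ := t - ε) ⟨le_rfl, by linarith⟩
  simpa using this
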